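/- Let W be a symmetric and singular discrete memoryless channel with R_cr < C(W), fix a rate R with R_∞ < R < C(W), set R̄ = (R + R_∞)/2, fix k > 0, and let R_N = R − k/N. Let x_o ∈ X and let x_o^N be the N-tuple with all entries x_o, and let S(r) = { y^N ∈ Y^N : (1/N) Σ_{n=1}^N ln(1/α_{y_n}) ≤ r } with α_y = Σ_{x: W(y|x)>0} |X|^{−1}. Then there exist a constant K̃ > 0 (depending on R, R̄ and W) and N₀ ∈ ℤ⁺ such that for all N ≥ N₀, W^N(S(R_N) | x_o^N) ≥ (K̃/√N) · exp(−N·E_SP(R)) > 0. -/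

import Mathlib

open Real Finset

variable {X Y : Type} [Fintype X] [Fintype Y]

/-- A discrete memoryless channel: `W x y` is the probability of output `y` given input `x`. -/
def IsDMC (W : X → Y → ℝ) : Prop :=
  (∀ x y, 0 ≤ W x y) ∧ ∀ x, ∑ y, W x y = 1

/-- A probability distribution on a finite alphabet. -/
def IsProbDist (Q : X → ℝ) : Prop :=
  (∀ x, 0 ≤ Q x) ∧ ∑ x, Q x = 1

/-- Gallager symmetry: the output alphabet can be partitioned into classes such that within
each class every row is a permutation of every other row, and every column is a permutation
of every other column. -/
def GallagerSymmetric (W : X → Y → ℝ) : Prop :=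
  ∃ cls : Y → ℕ,
    (∀ (l : ℕ) (x x' : X),
        ((Finset.univ.filter fun y => cls y = l).val.map fun y => W x y) =
        ((Finset.univ.filter fun y => cls y = l).val.map fun y => W x' y)) ∧
    (∀ y y' : Y, cls y = cls y' →
        (Finset.univ.val.map fun x => W x y) = (Finset.univ.val.map fun x => W x y'))

/-- Singularity: whenever two inputs both give an output positive probability,
they give it the same probability. -/
def Singular (W : X → Y → ℝ) : Prop :=
  ∀ x z y, 0 < W x y * W z y → W x y = W z y

/-- Gallager's function `E_o(ρ, Q)`. -/
noncomputable def Eo (W : X → Y → ℝ) (Q : X → ℝ) (ρ : ℝ) : ℝ :=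
  - Real.log (∑ y, (∑ x, Q x * W x y ^ (1 / (1 + ρ))) ^ (1 + ρ))

/-- Mutual information `I(Q; W)`. -/
noncomputable def mutualInfo (W : X → Y → ℝ) (Q : X → ℝ) : ℝ :=
  ∑ x, ∑ y, Q x * W x y * Real.log (W x y / ∑ z, Q z * W z y)

/-- Channel capacity `C(W)`. -/
noncomputable def capacity (W : X → Y → ℝ) : ℝ :=
  sSup {r | ∃ Q, IsProbDist Q ∧ r = mutualInfo W Q}

/-- The set of values whose supremum is the sphere-packing exponent. -/
def ESPset (W : X → Y → ℝ) (R : ℝ) : Set ℝ :=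
  {e | ∃ Q, IsProbDist Q ∧ ∃ ρ : ℝ, 0 ≤ ρ ∧ e = Eo W Q ρ - ρ * R}

/-- The sphere-packing exponent `E_SP(R) = max_Q sup_{ρ ≥ 0} (E_o(ρ,Q) - ρ R)`. -/
noncomputable def ESP (W : X → Y → ℝ) (R : ℝ) : ℝ := sSup (ESPset W R)

/-- The random coding exponent `E_r(R) = max_Q max_{0 ≤ ρ ≤ 1} (E_o(ρ,Q) - ρ R)`. -/
noncomputable def Er (W : X → Y → ℝ) (R : ℝ) : ℝ :=
  sSup {e | ∃ Q, IsProbDist Q ∧ ∃ ρ : ℝ, 0 ≤ ρ ∧ ρ ≤ 1 ∧ e = Eo W Q ρ - ρ * R}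

/-- `R_∞`: the supremum of rates at which the sphere-packing exponent is infinite
(i.e. the defining supremum is unbounded). -/
noncomputable def Rinf (W : X → Y → ℝ) : ℝ :=
  sSup {R | ¬ BddAbove (ESPset W R)}

/-- The critical rate `R_cr`: the smallest rate above which `E_r = E_SP`. -/
noncomputable def Rcr (W : X → Y → ℝ) : ℝ :=
  sInf {R | ∀ R', R ≤ R' → Er W R' = ESP W R'}

/-- Number of messages of an `(N, R)` code: `⌈e^{NR}⌉`. -/
noncomputable def Mof (N : ℕ) (R : ℝ) : ℕ := ⌈Real.exp (N * R)⌉₊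

/-- Error probability of message `m` for a (non-feedback) block code. -/
noncomputable def msgErrorProb (W : X → Y → ℝ) {N M : ℕ}
    (f : Fin M → Fin N → X) (φ : (Fin N → Y) → Fin M) (m : Fin M) : ℝ :=
  ∑ y ∈ Finset.univ.filter (fun y : Fin N → Y => φ y ≠ m), ∏ n, W (f m n) (y n)

/-- Average error probability of a (non-feedback) block code. -/
noncomputable def avgErrorProb (W : X → Y → ℝ) {N M : ℕ}
    (f : Fin M → Fin N → X) (φ : (Fin N → Y) → Fin M) : ℝ :=
  (M : ℝ)⁻¹ * ∑ m, msgErrorProb W f φ m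

/-- A feedback encoder, given as a function of the whole output word, is causal if the symbol
sent at time `n` depends only on the message and the outputs at times `< n`. -/
def Causal {N M : ℕ} (f : Fin M → (Fin N → Y) → Fin N → X) : Prop :=
  ∀ m y y' n, (∀ k, k < n → y k = y' k) → f m y n = f m y' n

/-- Average error probability of a feedback code. -/
noncomputable def avgErrorProbFb (W : X → Y → ℝ) {N M : ℕ}
    (f : Fin M → (Fin N → Y) → Fin N → X) (φ : (Fin N → Y) → Fin M) : ℝ :=
  (M : ℝ)⁻¹ * ∑ m, ∑ y ∈ Finset.univ.filter (fun y : Fin N → Y => φ y ≠ m),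
      ∏ n, W (f m y n) (y n)

variable {X Y : Type} [Fintype X] [Fintype Y]

/-- `α_y = Σ_{x : W(y|x) > 0} |X|⁻¹`. -/
noncomputable def alphaU (W : X → Y → ℝ) (y : Y) : ℝ :=
  ∑ x ∈ Finset.univ.filter (fun x => 0 < W x y), (Fintype.card X : ℝ)⁻¹

/-- `S(r) = { y^N : (1/N) Σ_n ln (1/α_{y_n}) ≤ r }`, as a finset of output words. -/
noncomputable def Sset (W : X → Y → ℝ) (N : ℕ) (r : ℝ) : Finset (Fin N → Y) :=
  Finset.univ.filter fun y : Fin N → Y =>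
    (N : ℝ)⁻¹ * ∑ n, Real.log (alphaU W (y n))⁻¹ ≤ r

theorem sixteen_pow_le_mul_centralBinom_sq (n : ℕ) (hn : 0 < n) :
    (16 : ℝ) ^ n ≤ 4 * n * (n.centralBinom : ℝ) ^ 2 := by
  induction n, hn using Nat.le_induction with
  | base => norm_num [Nat.centralBinom]
  | succ n hn ih =>
    have h : ((n : ℝ) + 1) * (n + 1).centralBinom = 2 * (2 * n + 1) * n.centralBinom := by
      exact_mod_cast Nat.succ_mul_centralBinom_succ n
    have hpos : (0 : ℝ) < (n : ℝ) + 1 := by positivity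
    push_cast
    refine le_of_mul_le_mul_left ?_ hpos
    calc ((n : ℝ) + 1) * 16 ^ (n + 1) = 16 * (n + 1) * 16 ^ n := by ring
      _ ≤ 16 * (n + 1) * (4 * n * (n.centralBinom : ℝ) ^ 2) := by gcongr
      _ ≤ 16 * (2 * n + 1) ^ 2 * (n.centralBinom : ℝ) ^ 2 := by
          nlinarith [sq_nonneg (n.centralBinom : ℝ)]
      _ = 4 * (2 * (2 * n + 1) * n.centralBinom) ^ 2 := by ring
      _ = ((n : ℝ) + 1) * (4 * (n + 1) * ((n + 1).centralBinom : ℝ) ^ 2) := by rw [← h]; ring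

theorem four_pow_le_sqrt_mul_centralBinom (n : ℕ) (hn : 0 < n) :
    (4 : ℝ) ^ n ≤ 2 * √n * n.centralBinom := by
  refine le_of_sq_le_sq ?_ (by positivity)
  calc ((4 : ℝ) ^ n) ^ 2 = 16 ^ n := by rw [← pow_mul, mul_comm, pow_mul]; norm_num
    _ ≤ 4 * n * (n.centralBinom : ℝ) ^ 2 := sixteen_pow_le_mul_centralBinom_sq n hn
    _ = (2 * √n * n.centralBinom) ^ 2 := by
        rw [mul_pow, mul_pow, Real.sq_sqrt (Nat.cast_nonneg n)]; norm_num

theorem exp_neg_two_mul_le_one_sub {x : ℝ} (h0 : 0 ≤ x) (h1 : x ≤ 1 / 2) :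
    Real.exp (-(2 * x)) ≤ 1 - x := by
  rw [Real.exp_neg, inv_le_iff_one_le_mul₀ (Real.exp_pos _)]
  nlinarith [Real.add_one_le_exp (2 * x)]

theorem centralBinom_mul_exp_le_choose (n i : ℕ) (hn : 0 < n) (hi : 4 * i ≤ n) :
    n.centralBinom * Real.exp (-(2 * (i : ℝ) ^ 2 / n)) ≤ (2 * n).choose (n + i) := by
  induction i with
  | zero => simp [Nat.centralBinom]
  | succ i ih =>
    have ih := ih (by omega)
    have hn' : (0 : ℝ) < n := by exact_mod_cast hn
    have hi' : 4 * ((i : ℝ) + 1) ≤ n := by exact_mod_cast hi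
    have hrec : ((2 * n).choose (n + (i + 1)) : ℝ) * (n + i + 1)
        = (2 * n).choose (n + i) * (n - i) := by
      have := Nat.choose_succ_right_eq (2 * n) (n + i)
      rw [show 2 * n - (n + i) = n - i by omega] at this
      have h2 : ((n - i : ℕ) : ℝ) = n - i := by rw [Nat.cast_sub (by omega)]
      rw [← h2]
      exact_mod_cast this
    have hx : Real.exp (-(2 * ((2 * i + 1) / n))) ≤ (n - i) / (n + i + 1 : ℝ) := by
      calc Real.exp (-(2 * ((2 * i + 1) / n)))
          ≤ Real.exp (-(2 * ((2 * i + 1) / (n + i + 1)))) := by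
            gcongr
            linarith [(Nat.cast_nonneg i : (0 : ℝ) ≤ i)]
        _ ≤ 1 - (2 * i + 1) / (n + i + 1) := by
            apply exp_neg_two_mul_le_one_sub (by positivity)
            rw [div_le_div_iff₀ (by positivity) (by norm_num)]
            linarith
        _ = _ := by field_simp; ring
    calc (n.centralBinom : ℝ) * Real.exp (-(2 * ((i + 1 : ℕ) : ℝ) ^ 2 / n))
        = (n.centralBinom * Real.exp (-(2 * (i : ℝ) ^ 2 / n)))
            * Real.exp (-(2 * ((2 * i + 1) / n))) := by
          rw [mul_assoc, ← Real.exp_add]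
          congr 2
          push_cast
          field_simp
          ring
      _ ≤ (2 * n).choose (n + i) * ((n - i) / (n + i + 1 : ℝ)) := by gcongr
      _ = (2 * n).choose (n + (i + 1)) := by
          rw [← mul_div_assoc, ← hrec]; field_simp

theorem choose_div_two_pow_ge {D : ℝ} (hD : 0 < D) {m j : ℕ} (hm : 8 * (D + 1) + 1 ≤ √(m : ℝ))
    (hj : |(j : ℝ) - m / 2| ≤ D * √(m : ℝ)) :
    Real.exp (-(6 * (D + 1) ^ 2)) / 4 / √(m : ℝ) ≤ (m.choose j : ℝ) / 2 ^ m := by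
  have hsm : √(m : ℝ) * √(m : ℝ) = m := Real.mul_self_sqrt (Nat.cast_nonneg m)
  have hm81 : (81 : ℝ) ≤ m := by nlinarith
  have hm1 : 81 ≤ m := by exact_mod_cast hm81
  obtain ⟨n, hn⟩ : ∃ n, n = m / 2 := ⟨_, rfl⟩
  have hn0 : 0 < n := by omega
  have hnm : (2 * n : ℝ) ≤ m := by exact_mod_cast (by omega : 2 * n ≤ m)
  have hmn : (m : ℝ) ≤ 2 * n + 1 := by exact_mod_cast (by omega : m ≤ 2 * n + 1)
  have hn0' : (1 : ℝ) ≤ n := by exact_mod_cast hn0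
  have hdist : |(j : ℝ) - n| ≤ (D + 1) * √(m : ℝ) := by
    have h1 := abs_le.1 hj
    rw [abs_le]
    constructor <;> nlinarith
  obtain ⟨i, hi, hji⟩ : ∃ i : ℕ, (i : ℝ) = |(j : ℝ) - n| ∧ (j = n + i ∨ n = j + i) := by
    rcases le_total n j with h | h
    · refine ⟨j - n, ?_, Or.inl (by omega)⟩
      rw [Nat.cast_sub h, abs_of_nonneg]
      exact sub_nonneg.2 (by exact_mod_cast h)
    · refine ⟨n - j, ?_, Or.inr (by omega)⟩
      rw [Nat.cast_sub h, abs_sub_comm, abs_of_nonneg]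
      exact sub_nonneg.2 (by exact_mod_cast h)
  rw [← hi] at hdist
  have h4 : 4 * i ≤ n := by
    have : 4 * (i : ℝ) ≤ n := by nlinarith
    exact_mod_cast this
  have hch : (2 * n).choose j = (2 * n).choose (n + i) := by
    rcases hji with h | h
    · rw [h]
    · exact Nat.choose_symm_of_eq_add (by omega)
  have hexp : Real.exp (-(6 * (D + 1) ^ 2)) ≤ Real.exp (-(2 * (i : ℝ) ^ 2 / n)) := by
    rw [Real.exp_le_exp, neg_le_neg_iff, div_le_iff₀ (by linarith)]
    have : (i : ℝ) ^ 2 ≤ (D + 1) ^ 2 * m := by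
      calc (i : ℝ) ^ 2 ≤ ((D + 1) * √(m : ℝ)) ^ 2 := by gcongr
        _ = _ := by rw [mul_pow, sq (√(m : ℝ)), hsm]
    have h3 : (D + 1) ^ 2 * m ≤ (D + 1) ^ 2 * (3 * n) := by gcongr; linarith
    linarith
  have hcb := four_pow_le_sqrt_mul_centralBinom n hn0
  have hsn : √(n : ℝ) ≤ √(m : ℝ) := Real.sqrt_le_sqrt (by linarith)
  have hsm0 : 0 < √(m : ℝ) := by linarith
  have hpow : (2 : ℝ) ^ m ≤ 2 * 4 ^ n := by
    calc (2 : ℝ) ^ m ≤ 2 ^ (2 * n + 1) := by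
          gcongr
          · norm_num
          · omega
      _ = 2 * 4 ^ n := by rw [pow_succ, pow_mul]; norm_num; ring
  have hmono : ((2 * n).choose j : ℝ) ≤ m.choose j := by
    exact_mod_cast Nat.choose_le_choose j (by omega : 2 * n ≤ m)
  rw [div_div, div_le_div_iff₀ (by positivity) (by positivity)]
  calc Real.exp (-(6 * (D + 1) ^ 2)) * 2 ^ m
      ≤ Real.exp (-(2 * (i : ℝ) ^ 2 / n)) * (2 * (2 * √(m : ℝ) * n.centralBinom)) := by
        gcongr
        exact hpow.trans (by gcongr; exact hcb.trans (by gcongr))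
    _ = (n.centralBinom * Real.exp (-(2 * (i : ℝ) ^ 2 / n))) * (4 * √(m : ℝ)) := by ring
    _ ≤ (m.choose j : ℝ) * (4 * √(m : ℝ)) := by
        gcongr
        exact (centralBinom_mul_exp_le_choose n i hn0 h4).trans (hch ▸ hmono)

/-- The expectation of `F` over words of length `N` with independent letters of weight `w`. -/
noncomputable def wordSum {Z : Type} [Fintype Z] (w : Z → ℝ) (N : ℕ) (F : (Fin N → Z) → ℝ) : ℝ :=
  ∑ z, (∏ n, w (z n)) * F z

section WordSum

variable {Z : Type} [Fintype Z] (w : Z → ℝ)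

theorem wordSum_zero (F : (Fin 0 → Z) → ℝ) : wordSum w 0 F = F Fin.elim0 := by
  simp only [wordSum, univ_unique, sum_singleton, univ_eq_empty, prod_empty, one_mul]
  congr 1

theorem wordSum_succ (N : ℕ) (F : (Fin (N + 1) → Z) → ℝ) :
    wordSum w (N + 1) F = ∑ a, w a * wordSum w N fun z => F (Fin.cons a z) := by
  simp only [wordSum, mul_sum]
  rw [← Fintype.sum_prod_type', ← (Fin.consEquiv fun _ => Z).sum_comp]
  refine sum_congr rfl fun p _ => ?_
  simp [Fin.consEquiv, Fin.prod_univ_succ, mul_assoc]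

theorem wordSum_add (N : ℕ) (F G : (Fin N → Z) → ℝ) :
    wordSum w N (fun z => F z + G z) = wordSum w N F + wordSum w N G := by
  simp [wordSum, mul_add, sum_add_distrib]

theorem wordSum_const_mul (N : ℕ) (c : ℝ) (F : (Fin N → Z) → ℝ) :
    wordSum w N (fun z => c * F z) = c * wordSum w N F := by
  simp only [wordSum, mul_sum]
  exact sum_congr rfl fun z _ => by ring

variable {w}

theorem wordSum_mono (hw : ∀ z, 0 ≤ w z) {N : ℕ} {F G : (Fin N → Z) → ℝ} (h : ∀ z, F z ≤ G z) :
    wordSum w N F ≤ wordSum w N G :=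
  sum_le_sum fun z _ => mul_le_mul_of_nonneg_left (h z) (prod_nonneg fun _ _ => hw _)

theorem wordSum_const (hw : ∑ z, w z = 1) (N : ℕ) (c : ℝ) : wordSum w N (fun _ => c) = c := by
  induction N with
  | zero => rw [wordSum_zero]
  | succ N ih => rw [wordSum_succ]; simp [ih, ← sum_mul, hw]

theorem wordSum_sum (hw : ∑ z, w z = 1) {τ : Z → ℝ} (hτ : ∑ z, w z * τ z = 0) (N : ℕ) :
    wordSum w N (fun z => ∑ n, τ (z n)) = 0 := by
  induction N with
  | zero => simp [wordSum_zero]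
  | succ N ih =>
    simp [wordSum_succ, Fin.sum_univ_succ, wordSum_add, ih, wordSum_const hw, hτ]

theorem wordSum_sum_sq (hw : ∑ z, w z = 1) {τ : Z → ℝ} (hτ : ∑ z, w z * τ z = 0) (N : ℕ) :
    wordSum w N (fun z => (∑ n, τ (z n)) ^ 2) = N * ∑ z, w z * τ z ^ 2 := by
  induction N with
  | zero => simp [wordSum_zero]
  | succ N ih =>
    simp only [wordSum_succ, Fin.sum_univ_succ, Fin.cons_zero, Fin.cons_succ, add_sq, wordSum_add,
      wordSum_const hw, wordSum_const_mul, wordSum_sum hw hτ, ih, mul_zero, add_zero, mul_add,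
      sum_add_distrib, ← sum_mul, hw]
    push_cast
    ring

end WordSum

/-- The average of `f` over a fair coin flip between the shifts by `a` and by `b`. -/
noncomputable def coinFlip (a b : ℝ) (f : ℝ → ℝ) (s : ℝ) : ℝ := (f (s + a) + f (s + b)) / 2

theorem coinFlip_nonneg {a b : ℝ} {f : ℝ → ℝ} (hf : ∀ s, 0 ≤ f s) (s : ℝ) :
    0 ≤ coinFlip a b f s := by
  have := hf (s + a)
  have := hf (s + b)
  unfold coinFlip
  positivity

theorem iterate_coinFlip_nonneg {a b : ℝ} {f : ℝ → ℝ} (hf : ∀ s, 0 ≤ f s) (m : ℕ) :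
    ∀ s, 0 ≤ (coinFlip a b)^[m] f s := by
  induction m with
  | zero => exact hf
  | succ m ih => rw [Function.iterate_succ_apply']; exact coinFlip_nonneg ih

theorem choose_mul_le_iterate_coinFlip {a b : ℝ} {f : ℝ → ℝ} (hf : ∀ s, 0 ≤ f s) (m : ℕ) :
    ∀ (j : ℕ) (s : ℝ), (m.choose j : ℝ) / 2 ^ m * f (s + (m - j) * a + j * b) ≤
      (coinFlip a b)^[m] f s := by
  induction m with
  | zero =>
    rintro (_ | j) s
    · simp
    · simpa using hf s
  | succ m ih =>
    intro j s
    rw [Function.iterate_succ_apply', coinFlip]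
    cases j with
    | zero =>
      have h1 := ih 0 (s + a)
      have h2 := iterate_coinFlip_nonneg (a := a) (b := b) hf m (s + b)
      have e : s + a + ((m : ℝ) - (0 : ℕ)) * a + (0 : ℕ) * b
          = s + (((m + 1 : ℕ) : ℝ) - (0 : ℕ)) * a + (0 : ℕ) * b := by push_cast; ring
      rw [e] at h1
      simp only [Nat.choose_zero_right, pow_succ] at h1 ⊢
      rw [← div_div, div_mul_eq_mul_div]
      linarith
    | succ j =>
      have h1 := ih (j + 1) (s + a)
      have h2 := ih j (s + b)
      have e1 : s + a + ((m : ℝ) - (j + 1 : ℕ)) * a + (j + 1 : ℕ) * b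
          = s + (((m + 1 : ℕ) : ℝ) - (j + 1 : ℕ)) * a + (j + 1 : ℕ) * b := by push_cast; ring
      have e2 : s + b + ((m : ℝ) - j) * a + j * b
          = s + (((m + 1 : ℕ) : ℝ) - (j + 1 : ℕ)) * a + (j + 1 : ℕ) * b := by push_cast; ring
      rw [e1] at h1
      rw [e2] at h2
      rw [Nat.choose_succ_succ, pow_succ, ← div_div, div_mul_eq_mul_div, Nat.cast_add, add_div,
        add_mul]
      linarith

/-- Splitting off a fair coin: a law `q` on letters that gives `coin` weight to a fair choice between
`ya` and `yb` can be sampled by first choosing at which positions to flip the coin. -/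
theorem wordSum_eq_wordSum_coinFlip {Y : Type} [Fintype Y] {q T : Y → ℝ} {w : Option Y → ℝ}
    {ya yb : Y}
    (hq : ∀ φ : Y → ℝ, ∑ y, q y * φ y
      = w none * ((φ ya + φ yb) / 2) + ∑ y, w (some y) * φ y)
    (f : ℝ → ℝ) (N : ℕ) : ∀ s : ℝ,
    wordSum q N (fun y => f (s + ∑ n, T (y n))) =
      wordSum w N (fun z => (coinFlip (T ya) (T yb))^[∑ n, if z n = none then 1 else 0] f
        (s + ∑ n, (z n).elim 0 T)) := by
  induction N with
  | zero => intro s; simp [wordSum_zero]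
  | succ N ih =>
    intro s
    simp only [wordSum_succ, Fin.sum_univ_succ, Fin.cons_zero, Fin.cons_succ, Fintype.sum_option,
      if_true, Option.elim_none, Option.elim_some, add_comm (1 : ℕ), Function.iterate_succ_apply', zero_add,
      reduceCtorEq, if_false, add_zero, ← add_assoc]
    simp only [ih, hq]
    congr 2
    rw [← wordSum_add, div_eq_inv_mul, ← wordSum_const_mul]
    congr 1
    funext z
    rw [coinFlip, add_right_comm s (T ya), add_right_comm s (T yb)]
    ring

theorem exists_le_iterate_coinFlip_indicator {a b k D θ : ℝ} (hab : a < b) (hk : 0 ≤ k)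
    (hD : 0 ≤ D) (hθ : 0 < θ) :
    ∃ C : ℝ, 0 < C ∧ ∃ N₀ : ℕ, 0 < N₀ ∧ ∀ N : ℕ, N₀ ≤ N → ∀ (m : ℕ) (s : ℝ), m ≤ N → θ * N ≤ m →
      |s + m * ((a + b) / 2)| ≤ D * √(N : ℝ) →
      C / √(N : ℝ) ≤
        (coinFlip a b)^[m] ((Set.Icc (-k - (b - a)) (-k)).indicator fun _ => 1) s := by
  obtain ⟨D', hD'⟩ : ∃ D', D' = (k + D / √θ) / (b - a) + 1 := ⟨_, rfl⟩
  have hδ : 0 < b - a := sub_pos.2 hab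
  have hsθ : 0 < √θ := Real.sqrt_pos.2 hθ
  have hD'0 : 1 ≤ D' := by rw [hD']; linarith [div_nonneg (add_nonneg hk (div_nonneg hD hsθ.le)) hδ.le]
  obtain ⟨N₀, hN₀⟩ := exists_nat_ge ((8 * (D' + 1) + 1) ^ 2 / θ)
  refine ⟨Real.exp (-(6 * (D' + 1) ^ 2)) / 4, by positivity, N₀ + 1, Nat.succ_pos _, ?_⟩
  intro N hN m s hmN hm hX
  have hN' : (N₀ : ℝ) ≤ N := by exact_mod_cast (Nat.le_succ _).trans hN
  have hsm : 8 * (D' + 1) + 1 ≤ √(m : ℝ) := by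
    apply Real.le_sqrt_of_sq_le
    rw [div_le_iff₀ hθ] at hN₀
    nlinarith
  have hmm : √(m : ℝ) * √(m : ℝ) = m := Real.mul_self_sqrt (Nat.cast_nonneg m)
  obtain ⟨u, hu⟩ : ∃ u, u = (-k - (s + m * ((a + b) / 2))) / (b - a) := ⟨_, rfl⟩
  have hNm : √(N : ℝ) ≤ √(m : ℝ) / √θ := by
    rw [le_div_iff₀ hsθ, ← Real.sqrt_mul (Nat.cast_nonneg N)]
    exact Real.sqrt_le_sqrt (by linarith)
  have hub : |u| + 1 ≤ D' * √(m : ℝ) := by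
    have h1 : |u| ≤ (k + D / √θ) / (b - a) * √(m : ℝ) := by
      rw [hu, abs_div, abs_of_pos hδ, div_mul_eq_mul_div]
      gcongr
      calc |-k - (s + m * ((a + b) / 2))| ≤ k + D * √(N : ℝ) := by
            rw [abs_le] at hX ⊢; constructor <;> linarith
        _ ≤ k * √(m : ℝ) + D * (√(m : ℝ) / √θ) := by
            gcongr
            exact le_mul_of_one_le_right hk (by linarith)
        _ = _ := by ring
    rw [hD', add_mul]
    linarith
  have hu2 := abs_le.1 (le_sub_iff_add_le.2 hub)
  have ht : 0 ≤ (m : ℝ) / 2 + u := by nlinarith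
  obtain ⟨j, hj⟩ : ∃ j, j = ⌊(m : ℝ) / 2 + u⌋₊ := ⟨_, rfl⟩
  have hj1 : (j : ℝ) ≤ m / 2 + u := hj ▸ Nat.floor_le ht
  have hj2 : (m : ℝ) / 2 + u < j + 1 := hj ▸ Nat.lt_floor_add_one _
  have huδ : u * (b - a) = -k - (s + m * ((a + b) / 2)) := by rw [hu]; field_simp
  have hmem : s + (m - j) * a + j * b ∈ Set.Icc (-k - (b - a)) (-k) := by
    constructor <;> nlinarith
  have hloc := choose_div_two_pow_ge (D := D') (j := j) (by linarith) hsm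
    (abs_le.2 ⟨by linarith, by linarith⟩)
  have hcoin := choose_mul_le_iterate_coinFlip (a := a) (b := b)
    (f := (Set.Icc (-k - (b - a)) (-k)).indicator fun _ => 1)
    (Set.indicator_nonneg fun _ _ => zero_le_one) m j s
  rw [Set.indicator_of_mem hmem, mul_one] at hcoin
  refine le_trans ?_ (hloc.trans hcoin)
  gcongr
  linarith

/-- A local lower bound: a nondegenerate centred random walk with finitely many step sizes hits a
window of fixed size with probability at least of order `1 / √N`. -/
theorem exists_le_wordSum_indicator {Y : Type} [Fintype Y] {q T : Y → ℝ} (hq : ∀ y, 0 ≤ q y)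
    (hq1 : ∑ y, q y = 1) (hT : ∑ y, q y * T y = 0) {ya yb : Y} (ha : 0 < q ya) (hb : 0 < q yb)
    (hab : T ya < T yb) {k : ℝ} (hk : 0 ≤ k) :
    ∃ C : ℝ, 0 < C ∧ ∃ N₀ : ℕ, 0 < N₀ ∧ ∀ N : ℕ, N₀ ≤ N →
      C / √(N : ℝ) ≤ wordSum q N fun y =>
        (Set.Icc (-k - (T yb - T ya)) (-k)).indicator (fun _ => 1) (∑ n, T (y n)) := by
  classical
  obtain ⟨θ, hθ⟩ : ∃ θ, θ = min (q ya) (q yb) := ⟨_, rfl⟩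
  have hθ0 : 0 < θ := hθ ▸ lt_min ha hb
  have hne : ya ≠ yb := fun h => hab.ne (by rw [h])
  obtain ⟨w, hwn, hws⟩ : ∃ w : Option Y → ℝ, w none = 2 * θ ∧ ∀ y, w (some y) =
      q y - θ * (if y = ya then 1 else 0) - θ * (if y = yb then 1 else 0) :=
    ⟨fun z => z.elim (2 * θ) fun y =>
      q y - θ * (if y = ya then 1 else 0) - θ * (if y = yb then 1 else 0), rfl, fun _ => rfl⟩
  have hw0 : ∀ z, 0 ≤ w z := by
    rintro (_ | y)
    · rw [hwn]; positivity
    · rw [hws]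
      have h1 : θ ≤ q ya := hθ ▸ min_le_left _ _
      have h2 : θ ≤ q yb := hθ ▸ min_le_right _ _
      by_cases hya : y = ya
      · subst hya; simpa [hne] using h1
      · by_cases hyb : y = yb
        · subst hyb; simpa [hya] using h2
        · simpa [hya, hyb] using hq y
  have hmix : ∀ φ : Y → ℝ, ∑ y, q y * φ y
      = w none * ((φ ya + φ yb) / 2) + ∑ y, w (some y) * φ y := by
    intro φ
    simp only [hwn, hws, sub_mul, sum_sub_distrib, mul_assoc, ← mul_sum, ite_mul, one_mul, zero_mul,
      sum_ite_eq', mem_univ, if_true]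
    ring
  have hw1 : ∑ z, w z = 1 := by
    have := hmix fun _ => 1
    rw [Fintype.sum_option]
    simp only [mul_one, hq1] at this
    linarith
  obtain ⟨a, ha'⟩ : ∃ a, a = T ya := ⟨_, rfl⟩
  obtain ⟨b, hb'⟩ : ∃ b, b = T yb := ⟨_, rfl⟩
  obtain ⟨τ, hτ⟩ : ∃ τ : Option Y → ℝ, τ = fun z => z.elim ((a + b) / 2) T := ⟨_, rfl⟩
  have hτ0 : ∑ z, w z * τ z = 0 := by
    have := hmix T
    rw [hT] at this
    rw [Fintype.sum_option, hτ, ha', hb']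
    exact this.symm
  obtain ⟨κ, hκ⟩ : ∃ κ : Option Y → ℝ, κ = fun z => (if z = none then 1 else 0) - 2 * θ := ⟨_, rfl⟩
  have hκ0 : ∑ z, w z * κ z = 0 := by
    simp [hκ, mul_sub, sum_sub_distrib, ← sum_mul, hw1, hwn]
  obtain ⟨v, hv⟩ : ∃ v, v = ∑ z, w z * τ z ^ 2 := ⟨_, rfl⟩
  obtain ⟨v', hv'⟩ : ∃ v', v' = ∑ z, w z * κ z ^ 2 := ⟨_, rfl⟩
  have hv0 : 0 ≤ v := hv ▸ sum_nonneg fun z _ => mul_nonneg (hw0 z) (sq_nonneg _)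
  obtain ⟨C, hC, N₀, hN₀, hwin⟩ := exists_le_iterate_coinFlip_indicator (D := √(4 * (v + 1)))
    (ha' ▸ hb' ▸ hab) hk (Real.sqrt_nonneg _) hθ0
  obtain ⟨N₁, hN₁⟩ := exists_nat_ge (4 * v' / θ ^ 2)
  refine ⟨C / 2, by positivity, max N₀ N₁, lt_max_of_lt_left hN₀, fun N hN => ?_⟩
  have hNpos : (0 : ℝ) < N := by exact_mod_cast hN₀.trans_le ((le_max_left _ _).trans hN)
  have hNN₁ : 4 * v' / θ ^ 2 ≤ N := hN₁.trans (by exact_mod_cast (le_max_right _ _).trans hN)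
  have hsplit := wordSum_eq_wordSum_coinFlip (T := T) hmix
    ((Set.Icc (-k - (b - a)) (-k)).indicator fun _ => 1) N 0
  simp only [zero_add, ← ha', ← hb'] at hsplit
  rw [← ha', ← hb', hsplit]
  have hpt : ∀ z : Fin N → Option Y,
      C / √(N : ℝ) * (1 + (-(1 / (4 * (v + 1) * N)) * (∑ n, τ (z n)) ^ 2
        + -(1 / (θ * N) ^ 2) * (∑ n, κ (z n)) ^ 2)) ≤
      (coinFlip a b)^[∑ n, if z n = none then 1 else 0]
        ((Set.Icc (-k - (b - a)) (-k)).indicator fun _ => 1) (∑ n, (z n).elim 0 T) := by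
    intro z
    obtain ⟨m, hm⟩ : ∃ m : ℕ, m = ∑ n, if z n = none then 1 else 0 := ⟨_, rfl⟩
    have hm' : (m : ℝ) = ∑ n, if z n = none then 1 else 0 := by rw [hm]; push_cast; rfl
    have hmN : m ≤ N := by
      rw [hm]
      calc (∑ n, if z n = none then 1 else 0) ≤ ∑ _n : Fin N, 1 :=
            sum_le_sum fun n _ => by split_ifs <;> simp
        _ = N := by simp
    have hsτ : ∑ n, τ (z n) = ∑ n, (z n).elim 0 T + m * ((a + b) / 2) := by
      rw [hm', sum_mul, ← sum_add_distrib]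
      refine sum_congr rfl fun n _ => ?_
      rw [hτ]
      cases z n <;> simp
    have hsκ : ∑ n, κ (z n) = m - 2 * θ * N := by
      rw [hm', hκ]
      simp [sum_sub_distrib, mul_comm]
    rw [hsτ, hsκ, ← hm]
    by_cases hgood : |∑ n, (z n).elim 0 T + m * ((a + b) / 2)| ≤ √(4 * (v + 1)) * √(N : ℝ) ∧
        θ * N ≤ m
    · refine le_trans ?_ (hwin N ((le_max_left _ _).trans hN) m _ hmN hgood.2 hgood.1)
      apply mul_le_of_le_one_right (by positivity)
      have : 0 ≤ 1 / (4 * (v + 1) * N) * (∑ n, (z n).elim 0 T + m * ((a + b) / 2)) ^ 2 := by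
        positivity
      have : 0 ≤ 1 / (θ * N) ^ 2 * (m - 2 * θ * N) ^ 2 := by positivity
      linarith
    · refine le_trans ?_ (iterate_coinFlip_nonneg (Set.indicator_nonneg fun _ _ => zero_le_one) m _)
      apply mul_nonpos_of_nonneg_of_nonpos (by positivity)
      have h1 : 0 ≤ 1 / (4 * (v + 1) * N) * (∑ n, (z n).elim 0 T + m * ((a + b) / 2)) ^ 2 := by
        positivity
      have h2 : 0 ≤ 1 / (θ * N) ^ 2 * (m - 2 * θ * N) ^ 2 := by positivity
      rw [not_and_or, not_le, not_le] at hgood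
      rcases hgood with h | h
      · have : 1 ≤ 1 / (4 * (v + 1) * N) * (∑ n, (z n).elim 0 T + m * ((a + b) / 2)) ^ 2 := by
          rw [one_div, ← div_eq_inv_mul, one_le_div (by positivity), ← sq_abs]
          rw [← Real.sqrt_mul (by positivity)] at h
          exact (Real.sqrt_le_left (abs_nonneg _)).1 h.le
        linarith
      · have : 1 ≤ 1 / (θ * N) ^ 2 * (m - 2 * θ * N) ^ 2 := by
          rw [one_div, ← div_eq_inv_mul, one_le_div (by positivity)]
          have := mul_pos hθ0 hNpos
          nlinarith
        linarith
  refine le_trans ?_ (wordSum_mono hw0 hpt)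
  rw [wordSum_const_mul, wordSum_add, wordSum_add, wordSum_const_mul, wordSum_const_mul,
    wordSum_const hw1, wordSum_sum_sq hw1 hτ0, wordSum_sum_sq hw1 hκ0, ← hv, ← hv', div_right_comm,
    div_eq_mul_one_div (C / √(N : ℝ))]
  gcongr
  have h1 : 1 / (4 * (v + 1) * N) * (N * v) ≤ 1 / 4 := by
    rw [one_div, ← div_eq_inv_mul, div_le_div_iff₀ (by positivity) (by norm_num)]
    nlinarith
  have h2 : 1 / (θ * N) ^ 2 * (N * v') ≤ 1 / 4 := by
    rw [div_le_iff₀ (by positivity)] at hNN₁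
    rw [one_div, ← div_eq_inv_mul, div_le_div_iff₀ (by positivity) (by norm_num)]
    nlinarith
  linarith

theorem exists_tilt_eq_zero {Y : Type} [Fintype Y] {p T : Y → ℝ} (hp : ∀ y, 0 ≤ p y)
    (hmean : 0 < ∑ y, p y * T y) {ya : Y} (ha : 0 < p ya) (hTa : T ya < 0) :
    ∃ ρ : ℝ, 0 ≤ ρ ∧ ∑ y, p y * Real.exp (-(ρ * T y)) * T y = 0 := by
  classical
  obtain ⟨h, hh⟩ : ∃ h : ℝ → ℝ, h = fun ρ => ∑ y, p y * Real.exp (-(ρ * T y)) * T y := ⟨_, rfl⟩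
  have hc : Continuous h := by rw [hh]; fun_prop
  have h0 : 0 < h 0 := by simpa [hh] using hmean
  obtain ⟨B, hB⟩ : ∃ B, B = ∑ y ∈ univ.erase ya, p y * |T y| := ⟨_, rfl⟩
  have hB0 : 0 ≤ B := hB ▸ sum_nonneg fun y _ => mul_nonneg (hp y) (abs_nonneg _)
  have hle : ∀ ρ, 0 ≤ ρ → h ρ ≤ B + p ya * (1 - ρ * T ya) * T ya := by
    intro ρ hρ
    rw [hh, hB]
    simp only
    rw [← sum_erase_add _ _ (mem_univ ya)]
    refine add_le_add (sum_le_sum fun y _ => ?_) ?_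
    · rw [mul_assoc]
      refine mul_le_mul_of_nonneg_left ?_ (hp y)
      rcases le_total 0 (T y) with hy | hy
      · rw [abs_of_nonneg hy]
        refine mul_le_of_le_one_left hy (Real.exp_le_one_iff.2 ?_)
        linarith [mul_nonneg hρ hy]
      · exact (mul_nonpos_of_nonneg_of_nonpos (Real.exp_pos _).le hy).trans (abs_nonneg _)
    · refine mul_le_mul_of_nonpos_right ?_ hTa.le
      refine mul_le_mul_of_nonneg_left ?_ (hp _)
      linarith [Real.add_one_le_exp (-(ρ * T ya))]
  have hden : 0 < p ya * T ya ^ 2 := mul_pos ha (sq_pos_of_neg hTa)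
  obtain ⟨r, hr⟩ : ∃ r, r = B / (p ya * T ya ^ 2) := ⟨_, rfl⟩
  have hr0 : 0 ≤ r := hr ▸ div_nonneg hB0 hden.le
  have hr1 : h r ≤ 0 := by
    have hBr : r * (p ya * T ya ^ 2) = B := by rw [hr, div_mul_cancel₀ _ hden.ne']
    have := hle r hr0
    nlinarith [mul_pos ha (neg_pos.2 hTa)]
  obtain ⟨ρ, hρ, hz⟩ := intermediate_value_Icc' hr0 hc.continuousOn ⟨hr1, h0.le⟩
  refine ⟨ρ, hρ.1, ?_⟩
  rw [hh] at hz
  exact hz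

/-- Lower bound of Bahadur–Rao type for the lower tail of a sum of independent letters. -/
theorem exists_le_wordSum_Iic {Y : Type} [Fintype Y] {p T : Y → ℝ} (hp : ∀ y, 0 ≤ p y)
    (hmean : 0 < ∑ y, p y * T y) {ya : Y} (ha : 0 < p ya) (hTa : T ya < 0) {k : ℝ} (hk : 0 ≤ k) :
    ∃ ρ : ℝ, 0 ≤ ρ ∧ ∃ C : ℝ, 0 < C ∧ ∃ N₀ : ℕ, 0 < N₀ ∧ ∀ N : ℕ, N₀ ≤ N →
      C / √(N : ℝ) * (∑ y, p y * Real.exp (-(ρ * T y))) ^ N ≤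
        wordSum p N fun y => (Set.Iic (-k)).indicator (fun _ => 1) (∑ n, T (y n)) := by
  obtain ⟨ρ, hρ, hzero⟩ := exists_tilt_eq_zero hp hmean ha hTa
  obtain ⟨M, hM⟩ : ∃ M, M = ∑ y, p y * Real.exp (-(ρ * T y)) := ⟨_, rfl⟩
  have hM0 : 0 < M := by
    rw [hM]
    exact sum_pos' (fun y _ => mul_nonneg (hp y) (Real.exp_pos _).le)
      ⟨ya, mem_univ _, mul_pos ha (Real.exp_pos _)⟩
  obtain ⟨q, hq⟩ : ∃ q : Y → ℝ, ∀ y, q y = p y * Real.exp (-(ρ * T y)) / M := ⟨_, fun _ => rfl⟩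
  have hq0 : ∀ y, 0 ≤ q y := fun y => by
    rw [hq]; exact div_nonneg (mul_nonneg (hp y) (Real.exp_pos _).le) hM0.le
  have hq1 : ∑ y, q y = 1 := by simp only [hq, ← sum_div, ← hM, div_self hM0.ne']
  have hqT : ∑ y, q y * T y = 0 := by
    simp only [hq, div_mul_eq_mul_div, ← sum_div, hzero, zero_div]
  have hqa : 0 < q ya := by rw [hq]; exact div_pos (mul_pos ha (Real.exp_pos _)) hM0
  obtain ⟨yb, hb, hTb⟩ : ∃ yb, 0 < q yb ∧ 0 < T yb := by
    by_contra! hcon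
    have : ∑ y, q y * T y < 0 := by
      refine sum_neg' (fun y _ => ?_) ⟨ya, mem_univ _, mul_neg_of_pos_of_neg hqa hTa⟩
      rcases (hq0 y).eq_or_lt with h | h
      · rw [← h, zero_mul]
      · exact mul_nonpos_of_nonneg_of_nonpos h.le (hcon y h)
    exact this.ne hqT
  obtain ⟨C, hC, N₀, hN₀, hwin⟩ :=
    exists_le_wordSum_indicator hq0 hq1 hqT hqa hb (hTa.trans hTb) hk
  refine ⟨ρ, hρ, C * Real.exp (-(ρ * (k + (T yb - T ya)))), by positivity, N₀, hN₀,
    fun N hN => ?_⟩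
  rw [← hM]
  calc C * Real.exp (-(ρ * (k + (T yb - T ya)))) / √(N : ℝ) * M ^ N
      = Real.exp (-(ρ * (k + (T yb - T ya)))) * M ^ N * (C / √(N : ℝ)) := by ring
    _ ≤ Real.exp (-(ρ * (k + (T yb - T ya)))) * M ^ N * _ :=
        mul_le_mul_of_nonneg_left (hwin N hN) (by positivity)
    _ ≤ _ := by
        rw [wordSum, wordSum, mul_sum]
        refine sum_le_sum fun y _ => ?_
        have hprod : ∏ n, q (y n) = (∏ n, p (y n)) * Real.exp (-(ρ * ∑ n, T (y n))) / M ^ N := by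
          simp only [hq, prod_div_distrib, prod_mul_distrib, ← Real.exp_sum, sum_neg_distrib,
            ← mul_sum, prod_const, card_univ, Fintype.card_fin]
        have hp' : 0 ≤ ∏ n, p (y n) := prod_nonneg fun _ _ => hp _
        by_cases hmem : ∑ n, T (y n) ∈ Set.Icc (-k - (T yb - T ya)) (-k)
        · rw [Set.indicator_of_mem hmem, Set.indicator_of_mem (Set.mem_Iic.2 hmem.2), hprod]
          calc _ = (∏ n, p (y n)) * Real.exp (-(ρ * (k + (T yb - T ya))) +
                -(ρ * ∑ n, T (y n))) := by rw [Real.exp_add]; field_simp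
            _ ≤ (∏ n, p (y n)) * 1 := by
                refine mul_le_mul_of_nonneg_left (Real.exp_le_one_iff.2 ?_) hp'
                nlinarith [hmem.1]
        · rw [Set.indicator_of_notMem hmem, mul_zero, mul_zero]
          exact mul_nonneg hp' (Set.indicator_nonneg (fun _ _ => zero_le_one) _)

section Channel

theorem alphaU_eq_map_sum (W : X → Y → ℝ) (y : Y) :
    alphaU W y = ((Finset.univ.val.map fun x => W x y).map
      fun t => if 0 < t then (Fintype.card X : ℝ)⁻¹ else 0).sum := by
  rw [Multiset.map_map, alphaU, sum_filter]
  rfl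

theorem alphaU_pos {W : X → Y → ℝ} (hcol : ∀ y, ∃ x, 0 < W x y) (y : Y) : 0 < alphaU W y := by
  obtain ⟨x, hx⟩ := hcol y
  have : Nonempty X := ⟨x⟩
  exact sum_pos (fun _ _ => by positivity) ⟨x, by simpa using hx⟩

theorem alphaU_le_one (W : X → Y → ℝ) (y : Y) : alphaU W y ≤ 1 := by
  rw [alphaU, sum_const, nsmul_eq_mul, ← div_eq_mul_inv]
  exact div_le_one_of_le₀ (by exact_mod_cast card_le_univ _) (Nat.cast_nonneg _)

theorem log_inv_alphaU_nonneg {W : X → Y → ℝ} (hcol : ∀ y, ∃ x, 0 < W x y) (y : Y) :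
    0 ≤ Real.log (alphaU W y)⁻¹ :=
  Real.log_nonneg ((one_le_inv₀ (alphaU_pos hcol y)).2 (alphaU_le_one W y))

/-- Under Gallager symmetry the law of `α_y` does not depend on the input. -/
theorem GallagerSymmetric.sum_mul_comp_alphaU {W : X → Y → ℝ} (hsym : GallagerSymmetric W)
    (g : ℝ → ℝ) (x x' : X) :
    ∑ y, W x y * g (alphaU W y) = ∑ y, W x' y * g (alphaU W y) := by
  obtain ⟨cls, hrow, hcolumn⟩ := hsym
  rw [← sum_fiberwise_of_maps_to (g := cls) (t := univ.image cls)
      fun y _ => mem_image_of_mem _ (mem_univ y),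
    ← sum_fiberwise_of_maps_to (g := cls) (t := univ.image cls)
      (f := fun y => W x' y * g (alphaU W y)) fun y _ => mem_image_of_mem _ (mem_univ y)]
  refine sum_congr rfl fun l hl => ?_
  obtain ⟨y₀, -, rfl⟩ := mem_image.1 hl
  have hfib : ∀ z, ∑ y with cls y = cls y₀, W z y * g (alphaU W y)
      = (∑ y with cls y = cls y₀, W z y) * g (alphaU W y₀) := by
    intro z
    rw [sum_mul]
    refine sum_congr rfl fun y hy => ?_
    rw [alphaU_eq_map_sum, alphaU_eq_map_sum, hcolumn y y₀ (mem_filter.1 hy).2]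
  rw [hfib, hfib]
  congr 1
  exact congrArg Multiset.sum (hrow (cls y₀) x x')

/-- Columns of a singular channel are constant on their support. -/
theorem Singular.sum_inv_card_mul {W : X → Y → ℝ} (hsing : Singular W) (hW : IsDMC W) {F : ℝ → ℝ}
    (hF : F 0 = 0) {z : X} {y : Y} (hz : 0 < W z y) :
    ∑ x, (Fintype.card X : ℝ)⁻¹ * F (W x y) = alphaU W y * F (W z y) := by
  rw [alphaU, sum_filter, sum_mul]
  refine sum_congr rfl fun x _ => ?_
  split_ifs with h
  · rw [hsing x z y (mul_pos h hz)]
  · rw [le_antisymm (not_lt.1 h) (hW.1 x y), hF, mul_zero, zero_mul]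

theorem isProbDist_uniform [Nonempty X] : IsProbDist fun _ : X => (Fintype.card X : ℝ)⁻¹ :=
  ⟨fun _ => by positivity, by simp⟩

theorem GallagerSymmetric.sum_uniform_mul [Nonempty X] {W : X → Y → ℝ} (hsym : GallagerSymmetric W)
    (g : ℝ → ℝ) (xo : X) :
    ∑ y, (∑ x, (Fintype.card X : ℝ)⁻¹ * W x y) * g (alphaU W y)
      = ∑ y, W xo y * g (alphaU W y) := by
  simp only [sum_mul]
  rw [sum_comm]
  simp only [mul_assoc, ← mul_sum, hsym.sum_mul_comp_alphaU g _ xo]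
  simp

theorem Eo_uniform [Nonempty X] {W : X → Y → ℝ} (hW : IsDMC W) (hsym : GallagerSymmetric W)
    (hsing : Singular W) (hcol : ∀ y, ∃ x, 0 < W x y) (xo : X) {ρ : ℝ} (hρ : 0 ≤ ρ) :
    Eo W (fun _ => (Fintype.card X : ℝ)⁻¹) ρ = -Real.log (∑ y, W xo y * alphaU W y ^ ρ) := by
  have hρ1 : 1 + ρ ≠ 0 := by positivity
  rw [Eo, ← hsym.sum_uniform_mul (fun t => t ^ ρ) xo]
  congr 2
  refine sum_congr rfl fun y _ => ?_
  obtain ⟨z, hz⟩ := hcol y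
  have hα := alphaU_pos hcol y
  rw [hsing.sum_inv_card_mul hW (F := fun t => t ^ (1 / (1 + ρ)))
      (Real.zero_rpow (one_div_ne_zero hρ1)) hz,
    hsing.sum_inv_card_mul hW (F := fun t => t) rfl hz,
    Real.mul_rpow hα.le (Real.rpow_nonneg hz.le _), ← Real.rpow_mul hz.le,
    one_div_mul_cancel hρ1, Real.rpow_one, Real.rpow_add hα, Real.rpow_one]
  ring

theorem Eo_uniform_sub_mul [Nonempty X] {W : X → Y → ℝ} (hW : IsDMC W)
    (hsym : GallagerSymmetric W) (hsing : Singular W) (hcol : ∀ y, ∃ x, 0 < W x y) (xo : X)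
    {ρ : ℝ} (hρ : 0 ≤ ρ) (R : ℝ) :
    Eo W (fun _ => (Fintype.card X : ℝ)⁻¹) ρ - ρ * R
      = -Real.log (∑ y, W xo y * Real.exp (-(ρ * (Real.log (alphaU W y)⁻¹ - R)))) := by
  have hsum : ∑ y, W xo y * Real.exp (-(ρ * (Real.log (alphaU W y)⁻¹ - R)))
      = (∑ y, W xo y * alphaU W y ^ ρ) * Real.exp (ρ * R) := by
    rw [sum_mul]
    refine sum_congr rfl fun y _ => ?_
    rw [Real.rpow_def_of_pos (alphaU_pos hcol y), mul_assoc, ← Real.exp_add, Real.log_inv]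
    congr 2
    ring
  have hpos : 0 < ∑ y, W xo y * alphaU W y ^ ρ := by
    obtain ⟨y, -, hy⟩ : ∃ y ∈ univ, 0 < W xo y :=
      exists_lt_of_sum_lt (f := fun _ => 0) (by simp [hW.2 xo])
    exact sum_pos' (fun y _ => mul_nonneg (hW.1 _ _) (Real.rpow_nonneg (alphaU_pos hcol y).le _))
      ⟨y, mem_univ _, mul_pos hy (Real.rpow_pos_of_pos (alphaU_pos hcol y) _)⟩
  rw [hsum, Real.log_mul hpos.ne' (Real.exp_pos _).ne', Real.log_exp,
    Eo_uniform hW hsym hsing hcol xo hρ]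
  ring

theorem Eo_le [Nonempty X] {W : X → Y → ℝ} (hW : IsDMC W) {Q : X → ℝ} (hQ : IsProbDist Q) {ρ : ℝ}
    (hρ : 0 ≤ ρ) : Eo W Q ρ ≤ (1 + ρ) * Real.log (Fintype.card X) := by
  have hcard : (0 : ℝ) < Fintype.card X := by exact_mod_cast Fintype.card_pos
  obtain ⟨x, -, hx⟩ : ∃ x ∈ univ, (Fintype.card X : ℝ)⁻¹ ≤ Q x :=
    exists_le_of_sum_le (univ_nonempty (α := X)) (by simp [hQ.2])
  have hlow : ((Fintype.card X : ℝ)⁻¹) ^ (1 + ρ)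
      ≤ ∑ y, (∑ x, Q x * W x y ^ (1 / (1 + ρ))) ^ (1 + ρ) := by
    calc ((Fintype.card X : ℝ)⁻¹) ^ (1 + ρ)
        = ∑ y, ((Fintype.card X : ℝ)⁻¹ * W x y ^ (1 / (1 + ρ))) ^ (1 + ρ) := by
          have : ∀ y, ((Fintype.card X : ℝ)⁻¹ * W x y ^ (1 / (1 + ρ))) ^ (1 + ρ)
              = ((Fintype.card X : ℝ)⁻¹) ^ (1 + ρ) * W x y := fun y => by
            rw [Real.mul_rpow (by positivity) (Real.rpow_nonneg (hW.1 x y) _),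
              ← Real.rpow_mul (hW.1 x y), one_div_mul_cancel (by positivity), Real.rpow_one]
          simp only [this, ← mul_sum, hW.2 x, mul_one]
      _ ≤ _ := by
          refine sum_le_sum fun y _ => ?_
          have hnn : ∀ z, 0 ≤ W z y ^ (1 / (1 + ρ)) := fun z => Real.rpow_nonneg (hW.1 z y) _
          refine Real.rpow_le_rpow (mul_nonneg (by positivity) (hnn x)) ?_ (by positivity)
          exact (mul_le_mul_of_nonneg_right hx (hnn x)).trans
            (single_le_sum (f := fun z => Q z * W z y ^ (1 / (1 + ρ)))
              (fun z _ => mul_nonneg (hQ.1 z) (hnn z)) (mem_univ x))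
  have := Real.log_le_log (by positivity) hlow
  rw [Real.log_rpow (by positivity), Real.log_inv] at this
  rw [Eo]
  linarith

theorem bddAbove_setOf_not_bddAbove_ESPset [Nonempty X] {W : X → Y → ℝ} (hW : IsDMC W) :
    BddAbove {R | ¬ BddAbove (ESPset W R)} := by
  refine ⟨Real.log (Fintype.card X), fun R hR => ?_⟩
  by_contra! hlt
  refine hR ⟨Real.log (Fintype.card X), ?_⟩
  rintro _ ⟨Q, hQ, ρ, hρ, rfl⟩
  have := Eo_le hW hQ hρ
  nlinarith

theorem bddAbove_ESPset_of_Rinf_lt [Nonempty X] {W : X → Y → ℝ} (hW : IsDMC W) {R : ℝ}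
    (hR : Rinf W < R) : BddAbove (ESPset W R) := by
  by_contra h
  exact hR.not_ge (le_csSup (bddAbove_setOf_not_bddAbove_ESPset hW) h)

theorem exists_log_inv_alphaU_lt [Nonempty X] {W : X → Y → ℝ} (hW : IsDMC W)
    (hsym : GallagerSymmetric W) (hsing : Singular W) (hcol : ∀ y, ∃ x, 0 < W x y) (xo : X)
    {R : ℝ} (hR : Rinf W < R) : ∃ y, 0 < W xo y ∧ Real.log (alphaU W y)⁻¹ < R := by
  by_contra! hcon
  obtain ⟨R', hR', hR'R⟩ := exists_between hR
  obtain ⟨B, hB⟩ := bddAbove_ESPset_of_Rinf_lt hW hR'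
  have hδ : 0 < R - R' := sub_pos.2 hR'R
  have hlin : ∀ ρ : ℝ, 0 ≤ ρ → ρ * (R - R') ≤ B := by
    intro ρ hρ
    refine le_trans ?_ (hB ⟨_, isProbDist_uniform, ρ, hρ, rfl⟩)
    rw [Eo_uniform_sub_mul hW hsym hsing hcol xo hρ, le_neg]
    have hpos : 0 < ∑ y, W xo y * Real.exp (-(ρ * (Real.log (alphaU W y)⁻¹ - R'))) := by
      obtain ⟨y, -, hy⟩ : ∃ y ∈ univ, 0 < W xo y :=
        exists_lt_of_sum_lt (f := fun _ => 0) (by simp [hW.2 xo])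
      exact sum_pos' (fun y _ => mul_nonneg (hW.1 _ _) (Real.exp_pos _).le)
        ⟨y, mem_univ _, mul_pos hy (Real.exp_pos _)⟩
    rw [Real.log_le_iff_le_exp hpos]
    calc _ ≤ ∑ y, W xo y * Real.exp (-(ρ * (R - R'))) := by
          refine sum_le_sum fun y _ => ?_
          rcases (hW.1 xo y).eq_or_lt with h | h
          · rw [← h, zero_mul, zero_mul]
          · have := hcon y h
            gcongr
      _ = _ := by rw [← sum_mul, hW.2, one_mul]
  have h1 := hlin ((|B| + 1) / (R - R')) (by positivity)
  rw [div_mul_cancel₀ _ hδ.ne'] at h1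
  linarith [le_abs_self B]

theorem mutualInfo_le [Nonempty X] {W : X → Y → ℝ} (hW : IsDMC W) (hsym : GallagerSymmetric W)
    (hsing : Singular W) (hcol : ∀ y, ∃ x, 0 < W x y) (xo : X) {Q : X → ℝ} (hQ : IsProbDist Q) :
    mutualInfo W Q ≤ ∑ y, W xo y * Real.log (alphaU W y)⁻¹ := by
  have hu0 : ∀ y, 0 ≤ ∑ z, (Fintype.card X : ℝ)⁻¹ * W z y := fun y =>
    sum_nonneg fun z _ => mul_nonneg (by positivity) (hW.1 z y)
  have hr0 : ∀ y, 0 ≤ ∑ z, Q z * W z y := fun y =>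
    sum_nonneg fun z _ => mul_nonneg (hQ.1 z) (hW.1 z y)
  have hpt : ∀ x y, Q x * W x y * Real.log (W x y / ∑ z, Q z * W z y) ≤
      Q x * (W x y * Real.log (alphaU W y)⁻¹)
        + Q x * W x y * ((∑ z, (Fintype.card X : ℝ)⁻¹ * W z y) / (∑ z, Q z * W z y) - 1) := by
    intro x y
    rcases (mul_nonneg (hQ.1 x) (hW.1 x y)).eq_or_lt with h | h
    · rw [← h, ← mul_assoc, ← h]; simp
    · have hx : 0 < W x y := (hW.1 x y).lt_of_ne fun h0 => by simp [← h0] at h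
      have hr : 0 < ∑ z, Q z * W z y := h.trans_le
        (single_le_sum (f := fun z => Q z * W z y)
          (fun z _ => mul_nonneg (hQ.1 z) (hW.1 z y)) (mem_univ x))
      have hα := alphaU_pos hcol y
      rw [hsing.sum_inv_card_mul hW (F := fun t => t) rfl hx, ← mul_assoc, ← mul_add]
      refine mul_le_mul_of_nonneg_left ?_ h.le
      have h1 := Real.log_le_sub_one_of_pos (div_pos (mul_pos hα hx) hr)
      rw [Real.log_div (mul_pos hα hx).ne' hr.ne', Real.log_mul hα.ne' hx.ne'] at h1
      rw [Real.log_div hx.ne' hr.ne', Real.log_inv]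
      linarith
  have hdiv : ∑ x, ∑ y, Q x * W x y *
      ((∑ z, (Fintype.card X : ℝ)⁻¹ * W z y) / (∑ z, Q z * W z y) - 1) ≤ 0 := by
    rw [sum_comm]
    simp only [← sum_mul]
    calc _ ≤ ∑ y, ((∑ z, (Fintype.card X : ℝ)⁻¹ * W z y) - ∑ z, Q z * W z y) := by
          refine sum_le_sum fun y _ => ?_
          rcases (hr0 y).eq_or_lt with h | h
          · rw [← h]; simpa using hu0 y
          · rw [mul_sub, mul_div_cancel₀ _ h.ne', mul_one]
      _ = 0 := by
          rw [sum_sub_distrib, sum_comm, sum_comm (f := fun y z => Q z * W z y)]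
          simp [← mul_sum, hW.2, hQ.2]
  calc mutualInfo W Q ≤ ∑ x, ∑ y, (Q x * (W x y * Real.log (alphaU W y)⁻¹) + Q x * W x y *
        ((∑ z, (Fintype.card X : ℝ)⁻¹ * W z y) / (∑ z, Q z * W z y) - 1)) :=
        sum_le_sum fun x _ => sum_le_sum fun y _ => hpt x y
    _ ≤ ∑ x, ∑ y, Q x * (W x y * Real.log (alphaU W y)⁻¹) := by
        simp only [sum_add_distrib]
        linarith
    _ = _ := by
        simp only [← mul_sum, hsym.sum_mul_comp_alphaU (fun t => Real.log t⁻¹) _ xo]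
        rw [← sum_mul, hQ.2, one_mul]

theorem capacity_le [Nonempty X] {W : X → Y → ℝ} (hW : IsDMC W) (hsym : GallagerSymmetric W)
    (hsing : Singular W) (hcol : ∀ y, ∃ x, 0 < W x y) (xo : X) :
    capacity W ≤ ∑ y, W xo y * Real.log (alphaU W y)⁻¹ := by
  refine Real.sSup_le ?_
    (sum_nonneg fun y _ => mul_nonneg (hW.1 _ _) (log_inv_alphaU_nonneg hcol y))
  rintro _ ⟨Q, hQ, rfl⟩
  exact mutualInfo_le hW hsym hsing hcol xo hQ

theorem sum_Sset_eq_wordSum (W : X → Y → ℝ) (xo : X) {N : ℕ} (hN : 0 < N) (R k : ℝ) :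
    ∑ y ∈ Sset W N (R - k / N), ∏ n, W xo (y n) =
      wordSum (W xo) N fun y =>
        (Set.Iic (-k)).indicator (fun _ => 1) (∑ n, (Real.log (alphaU W (y n))⁻¹ - R)) := by
  classical
  have hN' : (0 : ℝ) < N := by exact_mod_cast hN
  rw [Sset, sum_filter, wordSum]
  refine sum_congr rfl fun y _ => ?_
  have hiff : (N : ℝ)⁻¹ * ∑ n, Real.log (alphaU W (y n))⁻¹ ≤ R - k / N ↔
      ∑ n, (Real.log (alphaU W (y n))⁻¹ - R) ∈ Set.Iic (-k) := by
    rw [Set.mem_Iic, sum_sub_distrib, inv_mul_le_iff₀ hN', mul_sub, mul_div_cancel₀ _ hN'.ne']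
    simp only [sum_const, card_univ, Fintype.card_fin, nsmul_eq_mul]
    constructor <;> intro h <;> linarith
  rw [Set.indicator_apply]
  simp only [hiff, mul_ite, mul_one, mul_zero]

end Channel

/-- **Lemma (singular-lem1)(ii)**: for a symmetric singular channel with `R_cr < C(W)`,
a rate `R_∞ < R < C(W)`, `k > 0` and `R_N = R - k/N`, there are `K̃ > 0` and `N₀` such
that `W^N(S(R_N) | x_o^N) ≥ (K̃/√N) e^{-N E_SP(R)} > 0` for all `N ≥ N₀`. -/
theorem statement15 {X Y : Type} [Fintype X] [Fintype Y] [Nonempty X] [Nonempty Y]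
    (W : X → Y → ℝ) (hW : IsDMC W) (hsym : GallagerSymmetric W) (hsing : Singular W)
    (hcol : ∀ y, ∃ x, 0 < W x y)
    (hcr : Rcr W < capacity W)
    (R : ℝ) (hR1 : Rinf W < R) (hR2 : R < capacity W)
    (k : ℝ) (hk : 0 < k) (xo : X) :
    ∃ K : ℝ, 0 < K ∧ ∃ N₀ : ℕ, 0 < N₀ ∧ ∀ N : ℕ, N₀ ≤ N →
      K / Real.sqrt N * Real.exp (-(N : ℝ) * ESP W R) ≤
          ∑ y ∈ Sset W N (R - k / N), ∏ n, W xo (y n) ∧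
        0 < ∑ y ∈ Sset W N (R - k / N), ∏ n, W xo (y n) := by
  obtain ⟨ya, ha, hTa⟩ := exists_log_inv_alphaU_lt hW hsym hsing hcol xo hR1
  have hmean : 0 < ∑ y, W xo y * (Real.log (alphaU W y)⁻¹ - R) := by
    simp only [mul_sub, sum_sub_distrib, ← sum_mul, hW.2, one_mul]
    linarith [capacity_le hW hsym hsing hcol xo]
  obtain ⟨ρ, hρ, C, hC, N₀, hN₀, hbound⟩ := exists_le_wordSum_Iic
    (T := fun y => Real.log (alphaU W y)⁻¹ - R) (hW.1 xo) hmean ha (sub_neg.2 hTa) hk.le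
  refine ⟨C, hC, N₀, hN₀, fun N hN => ?_⟩
  have hN0 : 0 < N := hN₀.trans_le hN
  have hM0 : 0 < ∑ y, W xo y * Real.exp (-(ρ * (Real.log (alphaU W y)⁻¹ - R))) :=
    sum_pos' (fun y _ => mul_nonneg (hW.1 _ _) (Real.exp_pos _).le)
      ⟨ya, mem_univ _, mul_pos ha (Real.exp_pos _)⟩
  have hESP := le_csSup (bddAbove_ESPset_of_Rinf_lt hW hR1)
    ⟨_, isProbDist_uniform, ρ, hρ, rfl⟩
  rw [Eo_uniform_sub_mul hW hsym hsing hcol xo hρ] at hESP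
  have hexp : Real.exp (-(N : ℝ) * ESP W R) ≤
      (∑ y, W xo y * Real.exp (-(ρ * (Real.log (alphaU W y)⁻¹ - R)))) ^ N := by
    rw [← Real.exp_log hM0, ← Real.exp_nat_mul, Real.exp_le_exp, neg_mul, ← mul_neg]
    exact mul_le_mul_of_nonneg_left (neg_le.1 hESP) (Nat.cast_nonneg N)
  have hmain : C / √(N : ℝ) * Real.exp (-(N : ℝ) * ESP W R) ≤
      ∑ y ∈ Sset W N (R - k / N), ∏ n, W xo (y n) := by
    rw [sum_Sset_eq_wordSum W xo hN0]
    exact (mul_le_mul_of_nonneg_left hexp (by positivity)).trans (hbound N hN)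
  have hN' : (0 : ℝ) < N := by exact_mod_cast hN0
  exact ⟨hmain, lt_of_lt_of_le (by positivity) hmain⟩
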